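/- Let m, d be integers with m ≥ d ≥ 2 and N = m^d. Then 𝔼L₂²(P_{Ω*_\}) < 𝔼L₂²(P_{Ω*_|}), i.e. the stratified sample from the partition with parameter θ = arctan(1/2) has strictly smaller expected squared L₂-discrepancy than jittered sampling. -/

import Mathlib

open MeasureTheory Real Set

noncomputable section

/-- The unit cube `[0,1]^d`. -/
def unitCube (d : ℕ) : Set (Fin d → ℝ) := Set.univ.pi fun _ => Set.Icc (0 : ℝ) 1

/-- The anchored half-open box `[0, z) = ∏ⱼ [0, zⱼ)`. -/
def lowerBox {d : ℕ} (z : Fin d → ℝ) : Set (Fin d → ℝ) := {y | ∀ i, 0 ≤ y i ∧ y i < z i}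

/-- The squared `L₂`-discrepancy of a point configuration `P` in `[0,1]^d`:
`∫_{[0,1]^d} (λ([0,z)) - (1/N) #{i : P i ∈ [0,z)})² dz`. -/
def L2sq {d : ℕ} {ι : Type} [Fintype ι] (P : ι → Fin d → ℝ) : ℝ :=
  ∫ z in unitCube d,
    ((volume (lowerBox z)).toReal
      - (Fintype.card ι : ℝ)⁻¹ * (Nat.card {i // P i ∈ lowerBox z} : ℝ)) ^ 2

/-- The joint distribution of the stratified sample associated to a partition `Ω`:
independent points, the `i`-th uniformly distributed on `Ω i`. -/
def stratified {d : ℕ} {ι : Type} [Fintype ι] (Ω : ι → Set (Fin d → ℝ)) :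
    Measure (ι → Fin d → ℝ) :=
  Measure.pi fun i => ProbabilityTheory.cond volume (Ω i)

/-- Expected squared `L₂`-discrepancy of the stratified sample from the partition `Ω`. -/
def expL2sq {d : ℕ} {ι : Type} [Fintype ι] (Ω : ι → Set (Fin d → ℝ)) : ℝ :=
  ∫ P, L2sq P ∂(stratified Ω)

/-- The rectangle `I = [0,2] × [0,1] ⊆ ℝ²`. -/
def I2 : Set (ℝ × ℝ) := Set.Icc (0 : ℝ) 2 ×ˢ Set.Icc (0 : ℝ) 1

open scoped Classical in
/-- The cell `Ω₁(θ)` of the one-parameter family of partitions of `[0,2] × [0,1]`. -/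
def Omega1 (θ : ℝ) : Set (ℝ × ℝ) :=
  if θ = π / 2 then Set.Icc (0 : ℝ) 1 ×ˢ Set.Icc (0 : ℝ) 1
  else if θ < arctan (1 / 2) then {p ∈ I2 | p.2 ≤ (1 - p.1) * tan θ + 1 / 2}
  else {p ∈ I2 | (p.1 - 1) * tan θ + p.2 ≤ 1 / 2}

/-- The cell `Ω₂(θ)`: the closure of the complement of `Ω₁(θ)` in `[0,2] × [0,1]`. -/
def Omega2 (θ : ℝ) : Set (ℝ × ℝ) := closure (I2 \ Omega1 θ)

/-- The anchor point `a = ((m-2)/m, (m-1)/m, …, (m-1)/m)`. -/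
def anchor (m d : ℕ) : Fin d → ℝ := fun j => if (j : ℕ) = 0 then ((m : ℝ) - 2) / m else ((m : ℝ) - 1) / m

/-- The two corner cells `a + (1/m)·(Ωᵢ(θ) × [0,1]^{d-2})`, `i = 1, 2`. -/
def cornerCell (m d : ℕ) (hd : 2 ≤ d) (θ : ℝ) (i : Fin 2) : Set (Fin d → ℝ) :=
  (fun x : Fin d → ℝ => fun j => anchor m d j + x j / m) ''
    {x : Fin d → ℝ |
      (x ⟨0, by omega⟩, x ⟨1, by omega⟩) ∈ (if i = 0 then Omega1 θ else Omega2 θ) ∧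
      ∀ j : Fin d, 2 ≤ (j : ℕ) → x j ∈ Set.Icc (0 : ℝ) 1}

/-- The axis-parallel grid cell of side `1/m` indexed by `k`. -/
def gridCell {d : ℕ} (m : ℕ) (k : Fin d → Fin m) : Set (Fin d → ℝ) :=
  Set.univ.pi fun j => Set.Ico ((k j : ℝ) / m) (((k j : ℝ) + 1) / m)

open scoped Classical in
/-- The partition `Ω*∼(θ)` of `[0,1]^d`: all grid cells of side `1/m` except the two
top-corner ones, which are replaced by the two cells `a + (1/m)·(Ωᵢ(θ) × [0,1]^{d-2})`. -/
def OmegaStarSim (m d : ℕ) (hd : 2 ≤ d) (θ : ℝ) : (Fin d → Fin m) → Set (Fin d → ℝ) :=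
  fun k =>
    if ∀ j : Fin d, (k j : ℕ) = (if (j : ℕ) = 0 then m - 2 else m - 1) then
      cornerCell m d hd θ 0
    else if ∀ j : Fin d, (k j : ℕ) = m - 1 then cornerCell m d hd θ 1
    else gridCell m k

end

noncomputable section Discrepancy

variable {d : ℕ} {ι : Type} [Fintype ι]

lemma lowerBox_eq_pi (z : Fin d → ℝ) :
    lowerBox z = Set.univ.pi fun i => Set.Ico (0 : ℝ) (z i) := by
  ext y; simp [lowerBox]

lemma measurableSet_lowerBox (z : Fin d → ℝ) : MeasurableSet (lowerBox z) := by
  rw [lowerBox_eq_pi]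
  exact MeasurableSet.univ_pi fun _ => measurableSet_Ico

lemma measurableSet_unitCube (d : ℕ) : MeasurableSet (unitCube d) :=
  MeasurableSet.univ_pi fun _ => measurableSet_Icc

lemma toReal_volume_lowerBox (z : Fin d → ℝ) :
    (volume (lowerBox z)).toReal = ∏ i, max (z i) 0 := by
  rw [lowerBox_eq_pi, Real.volume_pi_Ico, ENNReal.toReal_prod]
  simp [ENNReal.toReal_ofReal']

/-- The integrand of the squared discrepancy, with the counting function written as a sum of
indicators. -/
def discrepancySq (P : ι → Fin d → ℝ) (z : Fin d → ℝ) : ℝ :=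
  ((volume (lowerBox z)).toReal
      - (Fintype.card ι : ℝ)⁻¹ * ∑ i, (lowerBox z).indicator (fun _ => (1 : ℝ)) (P i)) ^ 2

lemma L2sq_eq_integral_discrepancySq (P : ι → Fin d → ℝ) :
    L2sq P = ∫ z in unitCube d, discrepancySq P z := by
  classical
  unfold L2sq discrepancySq
  congr 1
  ext z
  congr 3
  rw [Nat.card_eq_fintype_card, Fintype.card_subtype, Finset.card_filter]
  simp [Set.indicator_apply]

lemma measurable_discrepancySq :
    Measurable fun p : (ι → Fin d → ℝ) × (Fin d → ℝ) => discrepancySq p.1 p.2 := by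
  unfold discrepancySq
  simp only [toReal_volume_lowerBox]
  refine Measurable.pow_const (Measurable.sub (by fun_prop) ?_) 2
  refine Measurable.const_mul (Finset.measurable_sum _ fun i _ => ?_) _
  have h : MeasurableSet {p : (ι → Fin d → ℝ) × (Fin d → ℝ) | p.1 i ∈ lowerBox p.2} := by
    have h1 : {p : (ι → Fin d → ℝ) × (Fin d → ℝ) | p.1 i ∈ lowerBox p.2}
        = ⋂ j, ({p | 0 ≤ p.1 i j} ∩ {p | p.1 i j < p.2 j}) := by
      ext p; simp [lowerBox]
    rw [h1]
    refine MeasurableSet.iInter fun j => MeasurableSet.inter ?_ ?_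
    · exact measurableSet_le (by fun_prop) (by fun_prop)
    · exact measurableSet_lt (by fun_prop) (by fun_prop)
  exact (measurable_const (a := (1 : ℝ))).indicator h

lemma discrepancySq_le_one (P : ι → Fin d → ℝ) {z : Fin d → ℝ} (hz : z ∈ unitCube d) :
    discrepancySq P z ≤ 1 := by
  have hv0 : 0 ≤ (volume (lowerBox z)).toReal := ENNReal.toReal_nonneg
  have hv1 : (volume (lowerBox z)).toReal ≤ 1 := by
    rw [toReal_volume_lowerBox]
    exact Finset.prod_le_one (fun _ _ => le_max_right _ _)
      fun i _ => max_le (hz i (Set.mem_univ i)).2 zero_le_one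
  have hs0 : 0 ≤ ∑ i, (lowerBox z).indicator (fun _ => (1 : ℝ)) (P i) :=
    Finset.sum_nonneg fun i _ => Set.indicator_nonneg (fun _ _ => zero_le_one) _
  have hs1 : ∑ i, (lowerBox z).indicator (fun _ => (1 : ℝ)) (P i) ≤ Fintype.card ι := by
    calc ∑ i, (lowerBox z).indicator (fun _ => (1 : ℝ)) (P i) ≤ ∑ _i : ι, (1 : ℝ) :=
          Finset.sum_le_sum fun i _ => Set.indicator_le_self' (fun _ _ => zero_le_one) _
      _ = Fintype.card ι := by simp
  have hc0 : (0 : ℝ) ≤ (Fintype.card ι : ℝ)⁻¹ := by positivity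
  have hc1 : (Fintype.card ι : ℝ)⁻¹ * ∑ i, (lowerBox z).indicator (fun _ => (1 : ℝ)) (P i) ≤ 1 :=
    (mul_le_mul_of_nonneg_left hs1 hc0).trans (inv_mul_le_one)
  have := mul_nonneg hc0 hs0
  unfold discrepancySq
  rw [sq_le_one_iff_abs_le_one, abs_le]
  constructor <;> linarith

instance isFiniteMeasure_restrict_unitCube (d : ℕ) :
    IsFiniteMeasure ((volume : Measure (Fin d → ℝ)).restrict (unitCube d)) :=
  isFiniteMeasure_restrict.2 <| by rw [unitCube, volume_pi_pi]; simp

variable (μ : ι → Measure (Fin d → ℝ)) [∀ i, IsProbabilityMeasure (μ i)]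

lemma integrable_discrepancySq :
    Integrable (fun p : (ι → Fin d → ℝ) × (Fin d → ℝ) => discrepancySq p.1 p.2)
      ((Measure.pi μ).prod (volume.restrict (unitCube d))) := by
  refine Integrable.of_bound measurable_discrepancySq.aestronglyMeasurable 1 ?_
  have h := Measure.quasiMeasurePreserving_snd (μ := Measure.pi μ)
    (ν := (volume : Measure (Fin d → ℝ)).restrict (unitCube d)) |>.ae
      (ae_restrict_mem (measurableSet_unitCube d))
  filter_upwards [h] with p hp
  rw [Real.norm_of_nonneg (by unfold discrepancySq; positivity)]
  exact discrepancySq_le_one p.1 hp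

lemma variance_indicator_one (ν : Measure (Fin d → ℝ)) [IsProbabilityMeasure ν]
    {B : Set (Fin d → ℝ)} (hB : MeasurableSet B) :
    ProbabilityTheory.variance (B.indicator fun _ => (1 : ℝ)) ν = ν.real B - ν.real B ^ 2 := by
  have hL : MemLp (B.indicator fun _ => (1 : ℝ)) 2 ν := memLp_indicator_const 2 hB 1 (by simp)
  rw [ProbabilityTheory.variance_eq_sub hL]
  have : (B.indicator fun _ => (1 : ℝ)) ^ 2 = B.indicator fun _ => (1 : ℝ) := by
    ext x; by_cases hx : x ∈ B <;> simp [hx]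
  rw [this, integral_indicator_const _ hB]
  simp

lemma integral_discrepancySq (z : Fin d → ℝ) :
    ∫ P, discrepancySq P z ∂(Measure.pi μ)
      = ((volume (lowerBox z)).toReal
          - (Fintype.card ι : ℝ)⁻¹ * ∑ i, (μ i).real (lowerBox z)) ^ 2
        + (Fintype.card ι : ℝ)⁻¹ ^ 2
          * ∑ i, ((μ i).real (lowerBox z) - (μ i).real (lowerBox z) ^ 2) := by
  set v := (volume (lowerBox z)).toReal
  set c := (Fintype.card ι : ℝ)⁻¹
  have hB := measurableSet_lowerBox z
  have hL : ∀ i, MemLp ((lowerBox z).indicator fun _ => (1 : ℝ)) 2 (μ i) :=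
    fun i => memLp_indicator_const 2 hB 1 (by simp)
  set S : (ι → Fin d → ℝ) → ℝ :=
    ∑ i, fun P : ι → Fin d → ℝ => (lowerBox z).indicator (fun _ => (1 : ℝ)) (P i) with hS
  have hLi : ∀ i, MemLp (fun P : ι → Fin d → ℝ =>
      (lowerBox z).indicator (fun _ => (1 : ℝ)) (P i)) 2 (Measure.pi μ) := fun i =>
    (hL i).comp_measurePreserving (measurePreserving_eval μ i)
  have hSL : MemLp S 2 (Measure.pi μ) := memLp_finsetSum' _ fun i _ => hLi i
  have hS1 : ∫ P, S P ∂(Measure.pi μ) = ∑ i, (μ i).real (lowerBox z) := by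
    simp only [hS, Finset.sum_apply]
    rw [integral_finsetSum _ fun i _ => (hLi i).integrable (by norm_num)]
    refine Finset.sum_congr rfl fun i _ => ?_
    rw [integral_comp_eval (μ := μ) (i := i) (f := (lowerBox z).indicator fun _ => (1 : ℝ))
      (hL i).aestronglyMeasurable, integral_indicator_const _ hB]
    simp
  have hvar := ProbabilityTheory.variance_sum_pi hL
  have hvar' := ProbabilityTheory.variance_eq_sub hSL
  rw [← hS] at hvar
  rw [hvar] at hvar'
  simp only [variance_indicator_one _ hB, Pi.pow_apply] at hvar'
  have hexp : ∀ P, discrepancySq P z = v ^ 2 - 2 * v * c * S P + c ^ 2 * S P ^ 2 := by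
    intro P
    simp only [discrepancySq, hS, Finset.sum_apply]
    ring
  have i1 : Integrable S (Measure.pi μ) := hSL.integrable (by norm_num)
  have i2 : Integrable (fun P => S P ^ 2) (Measure.pi μ) := hSL.integrable_sq
  simp only [hexp]
  rw [integral_add (f := fun P => v ^ 2 - 2 * v * c * S P) ((integrable_const _).sub (i1.const_mul _)) (i2.const_mul _),
    integral_sub (integrable_const _) (i1.const_mul _), integral_const_mul, integral_const_mul, hvar',
    hS1]
  simp only [integral_const, probReal_univ, one_smul]
  ring

lemma expL2sq_eq_integral_integral (Ω : ι → Set (Fin d → ℝ))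
    (hΩ : ∀ i, IsProbabilityMeasure (ProbabilityTheory.cond volume (Ω i))) :
    expL2sq Ω = ∫ z in unitCube d, ∫ P, discrepancySq P z
      ∂(Measure.pi fun i => ProbabilityTheory.cond volume (Ω i)) := by
  unfold expL2sq stratified
  simp only [L2sq_eq_integral_discrepancySq]
  exact integral_integral_swap (integrable_discrepancySq _)

/-- Two stratifications that differ in two strata only, with the same expected number of sample
points in each anchored box, have expected squared discrepancies that differ by an explicit
integral. -/
lemma expL2sq_sub_expL2sq (Ω Ω' : ι → Set (Fin d → ℝ))
    (hΩ : ∀ i, IsProbabilityMeasure (ProbabilityTheory.cond volume (Ω i)))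
    (hΩ' : ∀ i, IsProbabilityMeasure (ProbabilityTheory.cond volume (Ω' i)))
    {i j : ι} (hij : i ≠ j) (hagree : ∀ k, k ≠ i → k ≠ j → Ω k = Ω' k)
    (hsum : ∀ z ∈ unitCube d,
      (ProbabilityTheory.cond volume (Ω i)).real (lowerBox z)
        + (ProbabilityTheory.cond volume (Ω j)).real (lowerBox z)
      = (ProbabilityTheory.cond volume (Ω' i)).real (lowerBox z)
        + (ProbabilityTheory.cond volume (Ω' j)).real (lowerBox z)) :
    expL2sq Ω - expL2sq Ω' = 2 * (Fintype.card ι : ℝ)⁻¹ ^ 2 * ∫ z in unitCube d,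
      ((ProbabilityTheory.cond volume (Ω i)).real (lowerBox z)
        * (ProbabilityTheory.cond volume (Ω j)).real (lowerBox z)
      - (ProbabilityTheory.cond volume (Ω' i)).real (lowerBox z)
        * (ProbabilityTheory.cond volume (Ω' j)).real (lowerBox z)) := by
  classical
  rw [expL2sq_eq_integral_integral Ω hΩ, expL2sq_eq_integral_integral Ω' hΩ',
    ← integral_const_mul]
  refine (integral_sub (integrable_discrepancySq _).integral_prod_right
    (integrable_discrepancySq _).integral_prod_right).symm.trans ?_
  refine setIntegral_congr_fun (measurableSet_unitCube d) fun z hz => ?_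
  have hz' := hsum z hz
  have split : ∀ f : ι → ℝ, ∑ k, f k = f i + (f j + ∑ k ∈ (Finset.univ.erase i).erase j, f k) := by
    intro f
    rw [Finset.add_sum_erase _ _ (by simp [hij.symm]), Finset.add_sum_erase _ _ (by simp)]
  have hrest : ∀ g : ℝ → ℝ,
      ∑ k ∈ (Finset.univ.erase i).erase j,
        g ((ProbabilityTheory.cond volume (Ω k)).real (lowerBox z))
      = ∑ k ∈ (Finset.univ.erase i).erase j,
        g ((ProbabilityTheory.cond volume (Ω' k)).real (lowerBox z)) := by
    intro g
    refine Finset.sum_congr rfl fun k hk => ?_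
    simp only [Finset.mem_erase, Finset.mem_univ, and_true] at hk
    rw [hagree k hk.2 hk.1]
  have h1 := hrest id
  have h2 := hrest fun x => x - x ^ 2
  simp only [id] at h1
  simp only [integral_discrepancySq]
  simp only [split, h1, h2]
  generalize (ProbabilityTheory.cond volume (Ω i)).real (lowerBox z) = a at *
  generalize (ProbabilityTheory.cond volume (Ω j)).real (lowerBox z) = b at *
  generalize (ProbabilityTheory.cond volume (Ω' i)).real (lowerBox z) = a' at *
  generalize (ProbabilityTheory.cond volume (Ω' j)).real (lowerBox z) = b' at *
  obtain rfl : a = a' + b' - b := by linarith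
  ring

end Discrepancy

noncomputable section Splitting

open scoped Pointwise

/-- Separates the first two coordinates of a vector from the remaining ones. -/
def splitTwo (e : ℕ) : (Fin (e + 2) → ℝ) ≃ᵐ (ℝ × ℝ) × (Fin e → ℝ) :=
  ((MeasurableEquiv.piFinSuccAbove (fun _ => ℝ) 0).trans
    ((MeasurableEquiv.refl ℝ).prodCongr (MeasurableEquiv.piFinSuccAbove (fun _ => ℝ) 0))).trans
    MeasurableEquiv.prodAssoc.symm

lemma splitTwo_apply {e : ℕ} (x : Fin (e + 2) → ℝ) :
    splitTwo e x = ((x 0, x 1), fun j => x j.succ.succ) := rfl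

lemma measurePreserving_splitTwo (e : ℕ) : MeasurePreserving (splitTwo e) := by
  have h1 := volume_preserving_piFinSuccAbove (fun _ : Fin (e + 2) => ℝ) 0
  have h2 := volume_preserving_piFinSuccAbove (fun _ : Fin (e + 1) => ℝ) 0
  exact (volume_preserving_prodAssoc.symm).comp
    (((MeasurePreserving.id (volume : Measure ℝ)).prod h2).comp h1)

lemma unitCube_eq_preimage_splitTwo (e : ℕ) :
    unitCube (e + 2) = splitTwo e ⁻¹'
      ((Set.Icc (0 : ℝ) 1 ×ˢ Set.Icc (0 : ℝ) 1) ×ˢ unitCube e) := by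
  ext x
  simp only [unitCube, Set.mem_pi, splitTwo_apply, Fin.forall_fin_succ (n := e + 1),
    Fin.forall_fin_succ (n := e), Set.mem_preimage, Set.mem_prod, Set.mem_univ, true_implies,
    and_assoc, Fin.succ_zero_eq_one]

lemma setIntegral_unitCube_mul_prod (e : ℕ) (f : ℝ × ℝ → ℝ) (g : ℝ → ℝ) :
    ∫ z in unitCube (e + 2), f (z 0, z 1) * ∏ j : Fin e, g (z j.succ.succ)
      = (∫ p in Set.Icc (0 : ℝ) 1 ×ˢ Set.Icc (0 : ℝ) 1, f p)
        * (∫ t in Set.Icc (0 : ℝ) 1, g t) ^ e := by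
  rw [unitCube_eq_preimage_splitTwo]
  refine ((measurePreserving_splitTwo e).setIntegral_preimage_emb
    (splitTwo e).measurableEmbedding (fun q => f q.1 * ∏ j, g (q.2 j)) _).trans ?_
  rw [Measure.volume_eq_prod, setIntegral_prod_mul f fun q : Fin e → ℝ => ∏ j, g (q j)]
  congr 1
  rw [unitCube, volume_pi, Measure.restrict_pi_pi, integral_fintype_prod_eq_prod fun _ => g]
  simp

/-- The product of a planar region with `[0,1]^e`. -/
def planarCylinder (e : ℕ) (R : Set (ℝ × ℝ)) : Set (Fin (e + 2) → ℝ) :=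
  {x | (x 0, x 1) ∈ R ∧ ∀ j : Fin e, x j.succ.succ ∈ Set.Icc (0 : ℝ) 1}

lemma volume_planarCylinder_inter (e : ℕ) (R : Set (ℝ × ℝ)) (w : Fin (e + 2) → ℝ) :
    volume (planarCylinder e R ∩ {x | ∀ j, x j < w j})
      = volume (R ∩ Set.Iio (w 0) ×ˢ Set.Iio (w 1))
        * ∏ j : Fin e, volume (Set.Icc (0 : ℝ) 1 ∩ Set.Iio (w j.succ.succ)) := by
  have h : planarCylinder e R ∩ {x | ∀ j, x j < w j} = splitTwo e ⁻¹'
      ((R ∩ Set.Iio (w 0) ×ˢ Set.Iio (w 1))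
        ×ˢ Set.univ.pi fun j : Fin e => Set.Icc (0 : ℝ) 1 ∩ Set.Iio (w j.succ.succ)) := by
    ext x
    simp only [planarCylinder, Fin.forall_fin_succ (n := e + 1), Fin.forall_fin_succ (n := e),
      splitTwo_apply, Set.mem_inter_iff, Set.mem_ofPred_eq, Set.mem_preimage, Set.mem_prod,
      Set.mem_pi, Set.mem_univ, true_implies, forall_and, Set.mem_Iio, Fin.succ_zero_eq_one]
    tauto
  rw [h, (measurePreserving_splitTwo e).measure_preimage_equiv, Measure.volume_eq_prod,
    Measure.prod_prod, volume_pi_pi]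

lemma volume_planarCylinder (e : ℕ) (R : Set (ℝ × ℝ)) :
    volume (planarCylinder e R) = volume R := by
  have h : planarCylinder e R = splitTwo e ⁻¹'
      (R ×ˢ Set.univ.pi fun _ : Fin e => Set.Icc (0 : ℝ) 1) := by
    ext x
    simp [planarCylinder, splitTwo_apply, Set.mem_pi, -Set.pi_univ_Icc, forall_and]
  rw [h, (measurePreserving_splitTwo e).measure_preimage_equiv, Measure.volume_eq_prod,
    Measure.prod_prod, volume_pi_pi]
  simp

lemma volume_image_anchor_add_div {m d : ℕ} (A : Set (Fin d → ℝ)) :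
    volume ((fun x : Fin d → ℝ => fun j => anchor m d j + x j / m) '' A)
      = ENNReal.ofReal (|((m : ℝ)⁻¹) ^ d|) * volume A := by
  have h : (fun x : Fin d → ℝ => fun j => anchor m d j + x j / m) '' A
      = anchor m d +ᵥ ((m : ℝ)⁻¹ • A) := by
    rw [← Set.image_vadd, ← Set.image_smul, Set.image_image]
    refine Set.image_congr fun x _ => ?_
    ext j
    simp [div_eq_inv_mul]
  rw [h, measure_vadd, Measure.addHaar_smul]
  simp

lemma cornerCell_eq_image {m e : ℕ} (hd : 2 ≤ e + 2) (θ : ℝ) (i : Fin 2) :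
    cornerCell m (e + 2) hd θ i
      = (fun x : Fin (e + 2) → ℝ => fun j => anchor m (e + 2) j + x j / m) ''
        planarCylinder e (if i = 0 then Omega1 θ else Omega2 θ) := by
  unfold cornerCell planarCylinder
  congr 1
  ext x
  simp [Fin.forall_fin_succ (n := e + 1), Fin.forall_fin_succ (n := e)]

/-- The rescaled coordinates in which the top corner is `[0,2] × [0,1]^(d-1)`. -/
def rescale (m d : ℕ) (z : Fin d → ℝ) : Fin d → ℝ := fun j => m * (z j - anchor m d j)

lemma cond_cornerCell_lowerBox {m e : ℕ} (hm : 2 ≤ m) {R : Set (ℝ × ℝ)} (hR : R ⊆ I2)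
    (hR1 : volume R = 1) (z : Fin (e + 2) → ℝ) :
    (ProbabilityTheory.cond volume
      ((fun x : Fin (e + 2) → ℝ => fun j => anchor m (e + 2) j + x j / m) ''
        planarCylinder e R)).real (lowerBox z)
      = volume.real (R ∩ Set.Iio (rescale m _ z 0) ×ˢ Set.Iio (rescale m _ z 1))
        * ∏ j : Fin e,
          volume.real (Set.Icc (0 : ℝ) 1 ∩ Set.Iio (rescale m _ z j.succ.succ)) := by
  have hm' : (2 : ℝ) ≤ m := by exact_mod_cast hm
  have hm0 : (0 : ℝ) < m := by linarith
  have hanchor : ∀ j, 0 ≤ anchor m (e + 2) j := by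
    intro j
    unfold anchor
    split_ifs
    · exact div_nonneg (by linarith) hm0.le
    · exact div_nonneg (by linarith) hm0.le
  have hnonneg : ∀ x ∈ planarCylinder e R, ∀ j, 0 ≤ x j := by
    intro x hx
    have h2 := hR hx.1
    simp only [I2, Set.mem_prod, Set.mem_Icc] at h2
    simp only [Fin.forall_fin_succ (n := e + 1), Fin.forall_fin_succ (n := e)]
    exact ⟨h2.1.1, h2.2.1, fun j => (hx.2 j).1⟩
  have himage : (fun x : Fin (e + 2) → ℝ => fun j => anchor m (e + 2) j + x j / m) ''
        planarCylinder e R ∩ lowerBox z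
      = (fun x : Fin (e + 2) → ℝ => fun j => anchor m (e + 2) j + x j / m) ''
        (planarCylinder e R ∩ {x | ∀ j, x j < rescale m _ z j}) := by
    rw [← Set.image_inter_preimage]
    congr 1
    ext x
    simp only [Set.mem_inter_iff, and_congr_right_iff]
    intro hx
    simp only [lowerBox, rescale, Set.mem_preimage, Set.mem_ofPred_eq]
    refine forall_congr' fun j => ?_
    have h0 : 0 ≤ anchor m (e + 2) j + x j / m :=
      add_nonneg (hanchor j) (div_nonneg (hnonneg x hx j) hm0.le)
    rw [and_iff_right h0, ← lt_sub_iff_add_lt', div_lt_iff₀ hm0, mul_comm]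
  have hne : ENNReal.ofReal (|((m : ℝ)⁻¹) ^ (e + 2)|) ≠ 0 := by
    simp [pow_pos hm0]
  rw [Measure.real, ProbabilityTheory.cond_apply' (measurableSet_lowerBox z), himage,
    volume_image_anchor_add_div, volume_image_anchor_add_div, volume_planarCylinder, hR1, mul_one,
    ← mul_assoc, ENNReal.inv_mul_cancel hne ENNReal.ofReal_ne_top, one_mul,
    volume_planarCylinder_inter, ENNReal.toReal_mul, ENNReal.toReal_prod]
  rfl

lemma volume_real_Icc_inter_Iio {t : ℝ} (ht : t ≤ 1) :
    volume.real (Set.Icc (0 : ℝ) 1 ∩ Set.Iio t) = max t 0 := by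
  have : Set.Icc (0 : ℝ) 1 ∩ Set.Iio t = Set.Ico 0 t := by
    ext x; simp only [Set.mem_inter_iff, Set.mem_Icc, Set.mem_Iio, Set.mem_Ico]
    constructor
    · rintro ⟨⟨h, _⟩, h'⟩; exact ⟨h, h'⟩
    · rintro ⟨h, h'⟩; exact ⟨⟨h, by linarith⟩, h'⟩
  rw [this, Real.volume_real_Ico, sub_zero]

end Splitting

section Planar

lemma integral_max_sub_pow {l c b : ℝ} (hlc : l ≤ c) (hlb : l ≤ b) (n : ℕ) :
    ∫ y in l..b, max (y - c) 0 ^ (n + 1) = max (b - c) 0 ^ (n + 2) / (n + 2) := by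
  have hn : (n : ℝ) + 2 ≠ 0 := by positivity
  have h := integral_eq_of_hasDerivAt_off_countable_of_le
    (fun y : ℝ => max (y - c) 0 ^ (n + 2) / (n + 2)) (fun y => max (y - c) 0 ^ (n + 1)) hlb
    (s := {c}) (Set.countable_singleton c) (by fun_prop) ?_
    ((by fun_prop : Continuous fun y : ℝ => max (y - c) 0 ^ (n + 1)).intervalIntegrable _ _)
  · rw [h, max_eq_right (sub_nonpos.2 hlc)]
    simp
  · rintro x ⟨-, hx⟩
    rcases lt_or_gt_of_ne (Set.mem_singleton_iff.not.1 hx) with hlt | hgt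
    · rw [max_eq_right (by linarith), zero_pow (by omega)]
      refine (hasDerivAt_const x (0 : ℝ)).congr_of_eventuallyEq ?_
      filter_upwards [Iio_mem_nhds hlt] with y hy
      rw [max_eq_right (sub_nonpos.2 (le_of_lt hy))]
      simp
    · rw [max_eq_left (by linarith)]
      have h1 : HasDerivAt (fun y : ℝ => (y - c) ^ (n + 2) / (n + 2)) ((x - c) ^ (n + 1)) x := by
        have h2 := (((hasDerivAt_id x).sub_const c).pow (n + 2)).div_const ((n : ℝ) + 2)
        simp only [id] at h2
        convert! h2 using 1
        rw [show n + 2 - 1 = n + 1 by omega]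
        push_cast
        field_simp
      refine h1.congr_of_eventuallyEq ?_
      filter_upwards [Ioi_mem_nhds hgt] with y hy
      rw [max_eq_left (sub_nonneg.2 (le_of_lt hy))]

lemma isClosed_I2 : IsClosed I2 := isClosed_Icc.prod isClosed_Icc

lemma convex_I2 : Convex ℝ I2 := (convex_Icc 0 2).prod (convex_Icc 0 1)

lemma Omega1_subset_I2 (θ : ℝ) : Omega1 θ ⊆ I2 := by
  unfold Omega1
  split_ifs
  · exact Set.prod_mono (Set.Icc_subset_Icc_right one_le_two) subset_rfl
  · exact fun p hp => hp.1
  · exact fun p hp => hp.1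

lemma Omega2_subset_I2 (θ : ℝ) : Omega2 θ ⊆ I2 :=
  closure_minimal Set.sdiff_subset isClosed_I2

lemma closure_ae_eq_of_convex {s : Set (ℝ × ℝ)} (hs : Convex ℝ s) : closure s =ᵐ[volume] s := by
  refine Filter.EventuallyLE.antisymm ?_ subset_closure.eventuallyLE
  refine ae_le_set.2 (measure_mono_null (fun x hx => ?_) (hs.addHaar_frontier volume))
  exact ⟨hx.1, fun h => hx.2 (interior_subset h)⟩

lemma I2_diff_Omega1_pi_div_two : I2 \ Omega1 (π / 2) = Set.Ioc (1 : ℝ) 2 ×ˢ Set.Icc (0 : ℝ) 1 := by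
  ext ⟨x, y⟩
  simp only [Omega1, I2, if_true, Set.mem_sdiff, Set.mem_prod, Set.mem_Icc, Set.mem_Ioc]
  constructor
  · rintro ⟨⟨⟨hx0, hx2⟩, hy⟩, h⟩
    exact ⟨⟨not_le.1 fun h' => h ⟨⟨hx0, h'⟩, hy⟩, hx2⟩, hy⟩
  · rintro ⟨⟨hx0, hx2⟩, hy⟩
    exact ⟨⟨⟨by linarith, hx2⟩, hy⟩, fun h => by linarith [h.1.2]⟩

lemma Omega1_arctan_half :
    Omega1 (arctan (1 / 2)) = {p ∈ I2 | p.1 / 2 + p.2 ≤ 1} := by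
  rw [Omega1, if_neg (arctan_lt_pi_div_two _).ne, if_neg (lt_irrefl _), tan_arctan]
  ext p
  simp only [Set.mem_ofPred_eq, and_congr_right_iff]
  intro _
  constructor <;> intro h <;> linarith

lemma I2_diff_Omega1_arctan_half :
    I2 \ Omega1 (arctan (1 / 2)) = I2 ∩ {p | 1 < p.1 / 2 + p.2} := by
  rw [Omega1_arctan_half]
  ext p
  simp only [Set.mem_sdiff, Set.mem_inter_iff, Set.mem_ofPred_eq, not_and, not_le]
  tauto

/-- A partition of the rectangle whose second cell is, up to its boundary, a convex complement. -/
lemma Omega2_ae_eq {θ : ℝ} (hθ : θ = π / 2 ∨ θ = arctan (1 / 2)) :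
    Omega2 θ =ᵐ[volume] (I2 \ Omega1 θ : Set (ℝ × ℝ)) := by
  refine closure_ae_eq_of_convex ?_
  rcases hθ with rfl | rfl
  · rw [I2_diff_Omega1_pi_div_two]
    exact (convex_Ioc 1 2).prod (convex_Icc 0 1)
  · rw [I2_diff_Omega1_arctan_half]
    refine convex_I2.inter ?_
    have h : IsLinearMap ℝ fun p : ℝ × ℝ => p.1 / 2 + p.2 :=
      ⟨fun p q => by simp; ring, fun c p => by simp; ring⟩
    exact convex_halfSpace_gt h 1

lemma measurableSet_Omega1 {θ : ℝ} (hθ : θ = π / 2 ∨ θ = arctan (1 / 2)) :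
    MeasurableSet (Omega1 θ) := by
  rcases hθ with rfl | rfl
  · rw [Omega1, if_pos rfl]
    exact measurableSet_Icc.prod measurableSet_Icc
  · rw [Omega1_arctan_half]
    exact isClosed_I2.measurableSet.inter
      (measurableSet_le (f := fun p : ℝ × ℝ => p.1 / 2 + p.2) (by fun_prop) measurable_const)

lemma Iio_prod_Iio_ae_eq (a b : ℝ) :
    (Set.Iio a ×ˢ Set.Iio b : Set (ℝ × ℝ)) =ᵐ[volume] (Set.Iic a ×ˢ Set.Iic b : Set (ℝ × ℝ)) :=
  Measure.set_prod_ae_eq Iio_ae_eq_Iic Iio_ae_eq_Iic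

lemma I2_inter_Iic_prod_Iic {a b : ℝ} (ha : a ≤ 2) (hb : b ≤ 1) :
    I2 ∩ Set.Iic a ×ˢ Set.Iic b = Set.Icc 0 a ×ˢ Set.Icc 0 b := by
  ext ⟨x, y⟩
  simp only [I2, Set.mem_inter_iff, Set.mem_prod, Set.mem_Icc, Set.mem_Iic]
  constructor
  · rintro ⟨⟨⟨h1, h2⟩, h3, h4⟩, h5, h6⟩; exact ⟨⟨h1, h5⟩, h3, h6⟩
  · rintro ⟨⟨h1, h2⟩, h3, h4⟩
    exact ⟨⟨⟨h1, h2.trans ha⟩, h3, h4.trans hb⟩, h2, h4⟩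

lemma volume_real_I2_inter {a b : ℝ} (ha : a ≤ 2) (hb : b ≤ 1) :
    volume.real (I2 ∩ Set.Iic a ×ˢ Set.Iic b) = max a 0 * max b 0 := by
  rw [I2_inter_Iic_prod_Iic ha hb, Measure.volume_eq_prod, measureReal_prod_prod,
    Real.volume_real_Icc, Real.volume_real_Icc, sub_zero, sub_zero]

lemma volume_real_vertical_inter {a b : ℝ} (ha : a ≤ 2) (hb : b ≤ 1) :
    volume.real ((I2 \ Omega1 (π / 2)) ∩ Set.Iic a ×ˢ Set.Iic b) = max (a - 1) 0 * max b 0 := by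
  have h : (I2 \ Omega1 (π / 2)) ∩ Set.Iic a ×ˢ Set.Iic b = Set.Ioc 1 a ×ˢ Set.Icc 0 b := by
    rw [I2_diff_Omega1_pi_div_two]
    ext ⟨x, y⟩
    simp only [Set.mem_inter_iff, Set.mem_prod, Set.mem_Icc, Set.mem_Ioc, Set.mem_Iic]
    constructor
    · rintro ⟨⟨⟨h1, h2⟩, h3, h4⟩, h5, h6⟩; exact ⟨⟨h1, h5⟩, h3, h6⟩
    · rintro ⟨⟨h1, h2⟩, h3, h4⟩
      exact ⟨⟨⟨h1, h2.trans ha⟩, h3, h4.trans hb⟩, h2, h4⟩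
  rw [h, Measure.volume_eq_prod, measureReal_prod_prod, Real.volume_real_Ioc,
    Real.volume_real_Icc, sub_zero]

lemma volume_real_triangle_inter {a b : ℝ} (ha : a ≤ 2) (hb : b ≤ 1) :
    volume.real ((I2 \ Omega1 (arctan (1 / 2))) ∩ Set.Iic a ×ˢ Set.Iic b)
      = max (b - (1 - a / 2)) 0 ^ 2 := by
  have h : (I2 \ Omega1 (arctan (1 / 2))) ∩ Set.Iic a ×ˢ Set.Iic b
      = (Set.Icc 0 a ×ˢ Set.Icc 0 b) ∩ {p | 1 < p.1 / 2 + p.2} := by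
    rw [I2_diff_Omega1_arctan_half, Set.inter_right_comm, I2_inter_Iic_prod_Iic ha hb]
  rw [h]
  rcases lt_or_ge b 0 with hb0 | hb0
  · rw [Set.Icc_eq_empty (not_le.2 hb0), max_eq_right (by linarith)]
    simp
  have hmeas : MeasurableSet
      ((Set.Icc 0 a ×ˢ Set.Icc 0 b) ∩ {p : ℝ × ℝ | 1 < p.1 / 2 + p.2}) :=
    (measurableSet_Icc.prod measurableSet_Icc).inter
      (measurableSet_lt (by fun_prop) (by fun_prop))
  have hslice : ∀ y : ℝ,
      volume ((fun x => (x, y)) ⁻¹'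
        ((Set.Icc 0 a ×ˢ Set.Icc 0 b) ∩ {p : ℝ × ℝ | 1 < p.1 / 2 + p.2}))
      = (Set.Icc 0 b).indicator (fun y => ENNReal.ofReal (2 * max (y - (1 - a / 2)) 0)) y := by
    intro y
    by_cases hy : y ∈ Set.Icc 0 b
    · have hs : (fun x => (x, y)) ⁻¹'
          ((Set.Icc 0 a ×ˢ Set.Icc 0 b) ∩ {p : ℝ × ℝ | 1 < p.1 / 2 + p.2})
          = Set.Ioc (2 - 2 * y) a := by
        ext x
        simp only [Set.mem_preimage, Set.mem_inter_iff, Set.mem_prod, hy, and_true,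
          Set.mem_ofPred_eq, Set.mem_Icc, Set.mem_Ioc]
        constructor
        · rintro ⟨⟨h1, h2⟩, h3⟩; exact ⟨by linarith, h2⟩
        · rintro ⟨h1, h2⟩; exact ⟨⟨by linarith [hy.2], h2⟩, by linarith⟩
      rw [hs, Set.indicator_of_mem hy, Real.volume_Ioc]
      rcases le_total (y - (1 - a / 2)) 0 with h0 | h0
      · rw [max_eq_right h0, ENNReal.ofReal_of_nonpos (by linarith)]
        simp
      · rw [max_eq_left h0]
        congr 1
        ring
    · have hs : (fun x => (x, y)) ⁻¹'
          ((Set.Icc 0 a ×ˢ Set.Icc 0 b) ∩ {p : ℝ × ℝ | 1 < p.1 / 2 + p.2}) = ∅ := by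
        ext x
        simp only [Set.mem_preimage, Set.mem_inter_iff, Set.mem_prod, hy, and_false,
          false_and, Set.mem_empty_iff_false]
      rw [hs, Set.indicator_of_notMem hy, measure_empty]
  have hI := integral_max_sub_pow (l := 0) (c := 1 - a / 2) (b := b) (by linarith) hb0 0
  rw [Measure.real, Measure.volume_eq_prod, Measure.prod_apply_symm hmeas]
  simp only [hslice]
  rw [lintegral_indicator measurableSet_Icc, ← ofReal_integral_eq_lintegral_ofReal
    ((by fun_prop : Continuous fun y : ℝ => 2 * max (y - (1 - a / 2)) 0).integrableOn_Icc)
    (Filter.Eventually.of_forall fun y => by positivity),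
    ENNReal.toReal_ofReal (integral_nonneg fun y => by positivity), integral_const_mul,
    integral_Icc_eq_integral_Ioc, ← intervalIntegral.integral_of_le hb0]
  simp only [zero_add, pow_one, Nat.cast_zero] at hI
  rw [hI]
  ring

lemma measureReal_inter_Iio_of_ae_eq {s t : Set (ℝ × ℝ)} (h : s =ᵐ[volume] t) (a b : ℝ) :
    volume.real (s ∩ Set.Iio a ×ˢ Set.Iio b) = volume.real (t ∩ Set.Iic a ×ˢ Set.Iic b) :=
  measureReal_congr (h.inter (Iio_prod_Iio_ae_eq a b))

lemma volume_real_Omega1_inter {θ : ℝ} (hθ : θ = π / 2 ∨ θ = arctan (1 / 2)) {a b : ℝ}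
    (ha : a ≤ 2) (hb : b ≤ 1) :
    volume.real (Omega1 θ ∩ Set.Iio a ×ˢ Set.Iio b)
      = max a 0 * max b 0 - volume.real (Omega2 θ ∩ Set.Iio a ×ˢ Set.Iio b) := by
  rw [measureReal_inter_Iio_of_ae_eq (Omega2_ae_eq hθ),
    measureReal_inter_Iio_of_ae_eq (Filter.EventuallyEq.refl _ (Omega1 θ)),
    ← volume_real_I2_inter ha hb, eq_sub_iff_add_eq]
  have hfin : volume (I2 ∩ Set.Iic a ×ˢ Set.Iic b) ≠ ⊤ := by
    rw [I2_inter_Iic_prod_Iic ha hb]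
    exact (isCompact_Icc.prod isCompact_Icc).measure_lt_top.ne
  rw [← measureReal_inter_add_sdiff (s := I2 ∩ Set.Iic a ×ˢ Set.Iic b)
    (measurableSet_Omega1 hθ) hfin]
  congr 2
  · ext p
    have := @Omega1_subset_I2 θ p
    simp only [Set.mem_inter_iff]
    tauto
  · rw [Set.inter_sdiff_distrib_right]
    ext p
    simp only [Set.mem_inter_iff, Set.mem_sdiff]
    tauto

lemma volume_eq_one_of_subset_I2 {R : Set (ℝ × ℝ)} (hR : R ⊆ I2)
    (h : volume.real (R ∩ Set.Iio 2 ×ˢ Set.Iio 1) = 1) : volume R = 1 := by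
  have hsub : I2 ⊆ Set.Iic 2 ×ˢ Set.Iic 1 := Set.prod_mono (fun _ hx => hx.2) fun _ hy => hy.2
  rw [measureReal_inter_Iio_of_ae_eq (Filter.EventuallyEq.refl _ R),
    Set.inter_eq_left.2 (hR.trans hsub)] at h
  exact (ENNReal.toReal_eq_one_iff _).1 h

lemma volume_real_Omega2_pi_div_two {a b : ℝ} (ha : a ≤ 2) (hb : b ≤ 1) :
    volume.real (Omega2 (π / 2) ∩ Set.Iio a ×ˢ Set.Iio b) = max (a - 1) 0 * max b 0 := by
  rw [measureReal_inter_Iio_of_ae_eq (Omega2_ae_eq (Or.inl rfl)), volume_real_vertical_inter ha hb]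

lemma volume_real_Omega2_arctan_half {a b : ℝ} (ha : a ≤ 2) (hb : b ≤ 1) :
    volume.real (Omega2 (arctan (1 / 2)) ∩ Set.Iio a ×ˢ Set.Iio b)
      = max (b - (1 - a / 2)) 0 ^ 2 := by
  rw [measureReal_inter_Iio_of_ae_eq (Omega2_ae_eq (Or.inr rfl)), volume_real_triangle_inter ha hb]

lemma volume_Omega2 {θ : ℝ} (hθ : θ = π / 2 ∨ θ = arctan (1 / 2)) : volume (Omega2 θ) = 1 := by
  refine volume_eq_one_of_subset_I2 (Omega2_subset_I2 θ) ?_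
  rcases hθ with rfl | rfl
  · rw [volume_real_Omega2_pi_div_two le_rfl le_rfl]; norm_num
  · rw [volume_real_Omega2_arctan_half le_rfl le_rfl]; norm_num

lemma volume_Omega1 {θ : ℝ} (hθ : θ = π / 2 ∨ θ = arctan (1 / 2)) : volume (Omega1 θ) = 1 := by
  refine volume_eq_one_of_subset_I2 (Omega1_subset_I2 θ) ?_
  rw [volume_real_Omega1_inter hθ le_rfl le_rfl]
  rcases hθ with rfl | rfl
  · rw [volume_real_Omega2_pi_div_two le_rfl le_rfl]; norm_num
  · rw [volume_real_Omega2_arctan_half le_rfl le_rfl]; norm_num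

end Planar

noncomputable section Gap

/-- The difference between the products of the two corner areas for the vertical and for the
diagonal partition of the rectangle, seen from the anchored box `[0,a) × [0,b)`. -/
def planarGap (a b : ℝ) : ℝ :=
  (max a 0 * max b 0 - max (a - 1) 0 * max b 0) * (max (a - 1) 0 * max b 0)
    - (max a 0 * max b 0 - max (b - (1 - a / 2)) 0 ^ 2) * max (b - (1 - a / 2)) 0 ^ 2

lemma planarGap_eq {a b : ℝ} (ha : a ≤ 2) :
    planarGap a b = max (a - 1) 0 * max (b - 0) 0 ^ 2
      - (max a 0 * max (b - (1 - a / 2)) 0 ^ 3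
        + max a 0 * (1 - a / 2) * max (b - (1 - a / 2)) 0 ^ 2
        - max (b - (1 - a / 2)) 0 ^ 4) := by
  have h1 : (max a 0 - max (a - 1) 0) * max (a - 1) 0 = max (a - 1) 0 := by
    rcases le_total a 1 with h | h
    · rw [max_eq_right (a := a - 1) (by linarith)]; ring
    · rw [max_eq_left (a := a - 1) (by linarith), max_eq_left (by linarith)]; ring
  have h2 : max b 0 * max (b - (1 - a / 2)) 0
      = (max (b - (1 - a / 2)) 0 + (1 - a / 2)) * max (b - (1 - a / 2)) 0 := by
    rcases le_total (b - (1 - a / 2)) 0 with h | h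
    · rw [max_eq_right h]; ring
    · rw [max_eq_left h, max_eq_left (by linarith)]; ring
  unfold planarGap
  rw [sub_zero]
  linear_combination (max b 0) ^ 2 * h1 - max a 0 * max (b - (1 - a / 2)) 0 * h2

lemma integral_planarGap_snd {a l : ℝ} (ha : a ≤ 2) (hl : l ≤ 0) :
    ∫ b in l..1, planarGap a b
      = 1 / 3 * max (a - 1) 0 ^ 1
        + (11 / 960 * max (a - 0) 0 ^ 5 - 1 / 24 * max (a - 0) 0 ^ 4) := by
  have i1 := integral_max_sub_pow (l := l) (c := 0) (b := 1) hl (by linarith) 1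
  have i2 := integral_max_sub_pow (l := l) (c := 1 - a / 2) (b := 1) (by linarith) (by linarith) 1
  have i3 := integral_max_sub_pow (l := l) (c := 1 - a / 2) (b := 1) (by linarith) (by linarith) 2
  have i4 := integral_max_sub_pow (l := l) (c := 1 - a / 2) (b := 1) (by linarith) (by linarith) 3
  have hU : max (a / 2) 0 = max a 0 / 2 := by
    rw [← max_div_div_right (by norm_num : (0 : ℝ) ≤ 2), zero_div]
  have hintegrable : ∀ (c : ℝ) (n : ℕ),
      IntervalIntegrable (fun b => max (b - c) 0 ^ n) volume l 1 := fun c n =>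
    (by fun_prop : Continuous fun b : ℝ => max (b - c) 0 ^ n).intervalIntegrable _ _
  have ha' : a * max a 0 = max a 0 ^ 2 := by
    rcases le_total a 0 with h | h
    · rw [max_eq_right h]; ring
    · rw [max_eq_left h]; ring
  simp only [planarGap_eq ha]
  rw [intervalIntegral.integral_sub ((hintegrable _ _).const_mul _)
      ((((hintegrable _ _).const_mul _).add ((hintegrable _ _).const_mul _)).sub (hintegrable _ _)),
    intervalIntegral.integral_sub (((hintegrable _ _).const_mul _).add ((hintegrable _ _).const_mul _))
      (hintegrable _ _),
    intervalIntegral.integral_add ((hintegrable _ _).const_mul _) ((hintegrable _ _).const_mul _)]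
  simp only [intervalIntegral.integral_const_mul]
  norm_num at i1 i2 i3 i4 ⊢
  rw [i1, i2, i3, i4, hU]
  linear_combination (max a 0 ^ 3 / 48) * ha'

lemma integral_planarGap {l k : ℝ} (hl : l ≤ 0) (hk : k ≤ 0) :
    ∫ a in k..2, ∫ b in l..1, planarGap a b = 1 / 45 := by
  have i1 := integral_max_sub_pow (l := k) (c := 1) (b := 2) (by linarith) (by linarith) 0
  have i4 := integral_max_sub_pow (l := k) (c := 0) (b := 2) (by linarith) (by linarith) 3
  have i5 := integral_max_sub_pow (l := k) (c := 0) (b := 2) (by linarith) (by linarith) 4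
  have hintegrable : ∀ (c : ℝ) (n : ℕ),
      IntervalIntegrable (fun b => max (b - c) 0 ^ n) volume k 2 := fun c n =>
    (by fun_prop : Continuous fun b : ℝ => max (b - c) 0 ^ n).intervalIntegrable _ _
  rw [intervalIntegral.integral_congr (g := fun a => 1 / 3 * max (a - 1) 0 ^ 1
        + (11 / 960 * max (a - 0) 0 ^ 5 - 1 / 24 * max (a - 0) 0 ^ 4)) fun a ha => ?_]
  · rw [intervalIntegral.integral_add ((hintegrable _ _).const_mul _)
        (((hintegrable _ _).const_mul _).sub ((hintegrable _ _).const_mul _)),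
      intervalIntegral.integral_sub ((hintegrable _ _).const_mul _) ((hintegrable _ _).const_mul _)]
    simp only [intervalIntegral.integral_const_mul]
    norm_num at i1 i4 i5 ⊢
    rw [i1, i4, i5]
    norm_num
  · rw [Set.uIcc_of_le (by linarith)] at ha
    exact integral_planarGap_snd ha.2 hl

lemma setIntegral_planarGap {m : ℕ} (hm : 2 ≤ m) :
    ∫ p in Set.Icc (0 : ℝ) 1 ×ˢ Set.Icc (0 : ℝ) 1,
      planarGap (m * p.1 - (m - 2)) (m * p.2 - (m - 1)) = (m : ℝ)⁻¹ ^ 2 / 45 := by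
  have hm' : (2 : ℝ) ≤ m := by exact_mod_cast hm
  have hm0 : (m : ℝ) ≠ 0 := by linarith
  have hcont : Continuous fun p : ℝ × ℝ =>
      planarGap (m * p.1 - (m - 2)) (m * p.2 - (m - 1)) := by
    unfold planarGap
    fun_prop
  rw [Measure.volume_eq_prod, setIntegral_prod _
    (hcont.continuousOn.integrableOn_compact (isCompact_Icc.prod isCompact_Icc))]
  simp only [integral_Icc_eq_integral_Ioc]
  simp only [← intervalIntegral.integral_of_le zero_le_one]
  simp only [intervalIntegral.integral_comp_mul_sub (planarGap _) hm0]
  rw [intervalIntegral.integral_comp_mul_sub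
    (fun a => (m : ℝ)⁻¹ • ∫ b in (m : ℝ) * 0 - (m - 1)..m * 1 - (m - 1), planarGap a b) hm0]
  simp only [smul_eq_mul, intervalIntegral.integral_const_mul]
  rw [show (m : ℝ) * 1 - (m - 1) = 1 by ring, show (m : ℝ) * 1 - (m - 2) = 2 by ring,
    integral_planarGap (by linarith) (by linarith)]
  ring

lemma setIntegral_Icc_max_sq_pos (m : ℕ) (hm : 2 ≤ m) :
    0 < ∫ t in Set.Icc (0 : ℝ) 1, max ((m : ℝ) * t - (m - 1)) 0 ^ 2 := by
  have hm' : (2 : ℝ) ≤ m := by exact_mod_cast hm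
  have hm0 : (m : ℝ) ≠ 0 := by linarith
  have h := integral_max_sub_pow (l := 1 - m) (c := 0) (b := 1) (by linarith) (by linarith) 1
  rw [integral_Icc_eq_integral_Ioc, ← intervalIntegral.integral_of_le zero_le_one,
    intervalIntegral.integral_comp_mul_sub (fun t => max t 0 ^ 2) hm0]
  norm_num at h ⊢
  rw [h]
  exact mul_pos (inv_pos.2 (by linarith)) (by norm_num)

end Gap

section Partition

lemma isProbabilityMeasure_cond_cornerCell {m d : ℕ} (hd : 2 ≤ d) (hm : 2 ≤ m) {θ : ℝ}
    (hθ : θ = π / 2 ∨ θ = arctan (1 / 2)) (i : Fin 2) :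
    IsProbabilityMeasure (ProbabilityTheory.cond volume (cornerCell m d hd θ i)) := by
  obtain ⟨e, rfl⟩ := Nat.exists_eq_add_of_le' hd
  have hm0 : (0 : ℝ) < m := by exact_mod_cast (by omega : 0 < m)
  have hvol : volume (if i = 0 then Omega1 θ else Omega2 θ) = 1 := by
    split_ifs
    exacts [volume_Omega1 hθ, volume_Omega2 hθ]
  rw [cornerCell_eq_image]
  refine ProbabilityTheory.cond_isProbabilityMeasure_of_finite ?_ ?_ <;>
    rw [volume_image_anchor_add_div, volume_planarCylinder, hvol, mul_one]
  · simp [pow_pos hm0]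
  · exact ENNReal.ofReal_ne_top

lemma isProbabilityMeasure_cond_gridCell {m d : ℕ} (hm : 2 ≤ m) (k : Fin d → Fin m) :
    IsProbabilityMeasure (ProbabilityTheory.cond volume (gridCell m k)) := by
  have hm0 : (0 : ℝ) < m := by exact_mod_cast (by omega : 0 < m)
  refine ProbabilityTheory.cond_isProbabilityMeasure_of_finite ?_ ?_ <;>
    rw [gridCell, Real.volume_pi_Ico]
  · refine Finset.prod_ne_zero_iff.2 fun j _ => ?_
    rw [← sub_div, add_sub_cancel_left]
    simp [hm0]
  · exact ENNReal.prod_ne_top fun j _ => ENNReal.ofReal_ne_top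

lemma isProbabilityMeasure_cond_OmegaStarSim {m d : ℕ} (hd : 2 ≤ d) (hm : 2 ≤ m) {θ : ℝ}
    (hθ : θ = π / 2 ∨ θ = arctan (1 / 2)) (k : Fin d → Fin m) :
    IsProbabilityMeasure (ProbabilityTheory.cond volume (OmegaStarSim m d hd θ k)) := by
  unfold OmegaStarSim
  split_ifs
  · exact isProbabilityMeasure_cond_cornerCell hd hm hθ 0
  · exact isProbabilityMeasure_cond_cornerCell hd hm hθ 1
  · exact isProbabilityMeasure_cond_gridCell hm k

lemma rescale_zero {m e : ℕ} (hm : 2 ≤ m) (z : Fin (e + 2) → ℝ) :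
    rescale m (e + 2) z 0 = m * z 0 - (m - 2) := by
  have hm0 : (m : ℝ) ≠ 0 := by exact_mod_cast (by omega : m ≠ 0)
  simp only [rescale, anchor, Fin.val_zero, if_true]
  field_simp

lemma rescale_of_ne_zero {m d : ℕ} (hm : 2 ≤ m) (z : Fin d → ℝ) {j : Fin d} (hj : (j : ℕ) ≠ 0) :
    rescale m d z j = m * z j - (m - 1) := by
  have hm0 : (m : ℝ) ≠ 0 := by exact_mod_cast (by omega : m ≠ 0)
  simp only [rescale, anchor, hj, if_false]
  field_simp

/-- The probability that the uniform point of a corner cell falls into an anchored box. -/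
lemma cond_cornerCell_real_lowerBox {m e : ℕ} (hd : 2 ≤ e + 2) (hm : 2 ≤ m) {θ : ℝ}
    (hθ : θ = π / 2 ∨ θ = arctan (1 / 2)) (i : Fin 2) {z : Fin (e + 2) → ℝ}
    (hz : z ∈ unitCube (e + 2)) :
    (ProbabilityTheory.cond volume (cornerCell m (e + 2) hd θ i)).real (lowerBox z)
      = volume.real ((if i = 0 then Omega1 θ else Omega2 θ)
          ∩ Set.Iio ((m : ℝ) * z 0 - (m - 2)) ×ˢ Set.Iio ((m : ℝ) * z 1 - (m - 1)))
        * ∏ j : Fin e, max ((m : ℝ) * z j.succ.succ - (m - 1)) 0 := by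
  have hvol : volume (if i = 0 then Omega1 θ else Omega2 θ) = 1 := by
    split_ifs
    exacts [volume_Omega1 hθ, volume_Omega2 hθ]
  have hsub : (if i = 0 then Omega1 θ else Omega2 θ) ⊆ I2 := by
    split_ifs
    exacts [Omega1_subset_I2 θ, Omega2_subset_I2 θ]
  rw [cornerCell_eq_image, cond_cornerCell_lowerBox hm hsub hvol, rescale_zero hm,
    rescale_of_ne_zero hm z (j := 1) (by simp)]
  congr 1
  refine Finset.prod_congr rfl fun j _ => ?_
  rw [rescale_of_ne_zero hm z (by simp), volume_real_Icc_inter_Iio]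
  have := (hz j.succ.succ (Set.mem_univ _)).2
  nlinarith [Nat.cast_nonneg (α := ℝ) m]

end Partition

/-- For integers `m ≥ d ≥ 2` and `N = m^d`, the stratified sample from the
partition `Ω*_\\ = Ω*∼(arctan (1/2))` has strictly smaller expected squared
`L₂`-discrepancy than jittered sampling (the grid partition `Ω*_| = Ω*∼(π/2)`). -/
theorem expL2sq_OmegaStarBackslash_lt_jittered (m d : ℕ) (hd : 2 ≤ d) (hm : d ≤ m) :
    expL2sq (OmegaStarSim m d hd (arctan (1 / 2)))
      < expL2sq (OmegaStarSim m d hd (π / 2)) := by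
  obtain ⟨e, rfl⟩ := Nat.exists_eq_add_of_le' hd
  have hm2 : 2 ≤ m := hd.trans hm
  have hmR : (0 : ℝ) < m := by exact_mod_cast (by omega : 0 < m)
  set kLeft : Fin (e + 2) → Fin m :=
    fun j => if (j : ℕ) = 0 then ⟨m - 2, by omega⟩ else ⟨m - 1, by omega⟩ with hkLeft
  set kRight : Fin (e + 2) → Fin m := fun _ => ⟨m - 1, by omega⟩ with hkRight
  have hne : kLeft ≠ kRight := by
    intro h
    have := congrArg Fin.val (congrFun h 0)
    simp only [hkLeft, hkRight, Fin.val_zero, if_true] at this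
    omega
  have hleft : ∀ θ, OmegaStarSim m (e + 2) hd θ kLeft = cornerCell m (e + 2) hd θ 0 := by
    intro θ
    unfold OmegaStarSim
    rw [if_pos]
    intro j
    simp only [hkLeft]
    split_ifs <;> rfl
  have hright : ∀ θ, OmegaStarSim m (e + 2) hd θ kRight = cornerCell m (e + 2) hd θ 1 := by
    intro θ
    unfold OmegaStarSim
    rw [if_neg, if_pos]
    · intro j; rfl
    · intro h
      have := h 0
      simp only [hkRight, Fin.val_zero, if_true] at this
      omega
  have hagree : ∀ k, k ≠ kLeft → k ≠ kRight →
      OmegaStarSim m (e + 2) hd (π / 2) k = OmegaStarSim m (e + 2) hd (arctan (1 / 2)) k := by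
    intro k h1 h2
    unfold OmegaStarSim
    rw [if_neg, if_neg, if_neg, if_neg]
    · exact fun h => h2 (funext fun j => Fin.ext (h j))
    · refine fun h => h1 (funext fun j => Fin.ext ((h j).trans ?_))
      simp only [hkLeft]
      split_ifs <;> rfl
    · exact fun h => h2 (funext fun j => Fin.ext (h j))
    · refine fun h => h1 (funext fun j => Fin.ext ((h j).trans ?_))
      simp only [hkLeft]
      split_ifs <;> rfl
  have hfst : ∀ z ∈ unitCube (e + 2), (m : ℝ) * z 0 - (m - 2) ≤ 2 := fun z hz => by
    have := mul_le_mul_of_nonneg_left (hz 0 (Set.mem_univ _)).2 hmR.le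
    linarith
  have hsnd : ∀ z ∈ unitCube (e + 2), (m : ℝ) * z 1 - (m - 1) ≤ 1 := fun z hz => by
    have := mul_le_mul_of_nonneg_left (hz 1 (Set.mem_univ _)).2 hmR.le
    linarith
  have hv : π / 2 = π / 2 ∨ π / 2 = arctan (1 / 2) := Or.inl rfl
  have hs : arctan (1 / 2) = π / 2 ∨ arctan (1 / 2) = arctan (1 / 2) := Or.inr rfl
  have hsub := expL2sq_sub_expL2sq (OmegaStarSim m (e + 2) hd (π / 2))
    (OmegaStarSim m (e + 2) hd (arctan (1 / 2)))
    (isProbabilityMeasure_cond_OmegaStarSim hd hm2 hv)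
    (isProbabilityMeasure_cond_OmegaStarSim hd hm2 hs) hne hagree (by
      intro z hz
      simp only [hleft, hright, cond_cornerCell_real_lowerBox hd hm2 hv _ hz,
        cond_cornerCell_real_lowerBox hd hm2 hs _ hz, if_true, one_ne_zero, if_false,
        volume_real_Omega1_inter hv (hfst z hz) (hsnd z hz),
        volume_real_Omega1_inter hs (hfst z hz) (hsnd z hz)]
      ring)
  rw [setIntegral_congr_fun (g := fun z => planarGap (m * z 0 - (m - 2)) (m * z 1 - (m - 1))
      * ∏ j : Fin e, max ((m : ℝ) * z j.succ.succ - (m - 1)) 0 ^ 2)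
    (measurableSet_unitCube _) fun z hz => by
      simp only [hleft, hright, cond_cornerCell_real_lowerBox hd hm2 hv _ hz,
        cond_cornerCell_real_lowerBox hd hm2 hs _ hz, if_true, one_ne_zero, if_false,
        volume_real_Omega1_inter hv (hfst z hz) (hsnd z hz),
        volume_real_Omega1_inter hs (hfst z hz) (hsnd z hz),
        volume_real_Omega2_pi_div_two (hfst z hz) (hsnd z hz),
        volume_real_Omega2_arctan_half (hfst z hz) (hsnd z hz), planarGap, Finset.prod_pow]
      ring,
    setIntegral_unitCube_mul_prod e
      (fun p => planarGap (m * p.1 - (m - 2)) (m * p.2 - (m - 1)))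
      fun t => max ((m : ℝ) * t - (m - 1)) 0 ^ 2,
    setIntegral_planarGap hm2] at hsub
  have hcard : (0 : ℝ) < (Fintype.card (Fin (e + 2) → Fin m) : ℝ) := by
    exact_mod_cast Fintype.card_pos_iff.2 ⟨kLeft⟩
  have hpos := pow_pos (setIntegral_Icc_max_sq_pos m hm2) e
  rw [← sub_pos, hsub]
  positivity
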